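/- Let a ∈ (0,1), θ ∈ (0,1) and σ₃ a nonnegative integer. For every t ≥ 0 there exists a constant C = C(t,a,θ,σ₃) such that for all f : ℝ² → ℂ with the right-hand side finite, ‖𝒟^θ_ξ(χ(ξ,η) ψ(ξ,η,t) η^{σ₃} f̂)‖_{L²(ℝ²)} ≤ C(‖f‖ + ‖|x|^θ f‖). -/

import Mathlib

open MeasureTheory Real Set
open scoped ENNReal

noncomputable section

/-- Fourier transform on ℝ². -/
def FT (f : ℝ × ℝ → ℂ) : ℝ × ℝ → ℂ := fun ζ =>
  ∫ p : ℝ × ℝ, Complex.exp (-(Complex.I * ((p.1 * ζ.1 + p.2 * ζ.2 : ℝ) : ℂ))) * f p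

/-- Inverse Fourier transform on ℝ². -/
def invFT (g : ℝ × ℝ → ℂ) : ℝ × ℝ → ℂ := fun p =>
  ((((2 * Real.pi) ^ 2 : ℝ)⁻¹ : ℝ) : ℂ) *
    ∫ ζ : ℝ × ℝ, Complex.exp (Complex.I * ((p.1 * ζ.1 + p.2 * ζ.2 : ℝ) : ℂ)) * g ζ

/-- Fourier multiplier operator with symbol `m`. -/
def fourierMult (m : ℝ × ℝ → ℂ) (f : ℝ × ℝ → ℂ) : ℝ × ℝ → ℂ :=
  invFT fun ζ => m ζ * FT f ζ

/-- Bessel operator in the x-direction, symbol (1+ξ²)^{s/2}. -/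
def Jx (s : ℝ) : (ℝ × ℝ → ℂ) → ℝ × ℝ → ℂ :=
  fourierMult fun ζ => (((1 + ζ.1 ^ 2) ^ (s / 2) : ℝ) : ℂ)

/-- Riesz operator in the x-direction, symbol |ξ|^s. -/
def Dx (s : ℝ) : (ℝ × ℝ → ℂ) → ℝ × ℝ → ℂ :=
  fourierMult fun ζ => ((|ζ.1| ^ s : ℝ) : ℂ)

/-- Riesz operator in the y-direction, symbol |η|^s. -/
def Dy (s : ℝ) : (ℝ × ℝ → ℂ) → ℝ × ℝ → ℂ :=
  fourierMult fun ζ => ((|ζ.2| ^ s : ℝ) : ℂ)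

/-- The symbol ψ(ξ,η,t) = exp(i t ξ(η² − |ξ|^{1+a})) of the linear gBO-ZK group. -/
def psi (a t : ℝ) (ζ : ℝ × ℝ) : ℂ :=
  Complex.exp (Complex.I * ((t * ζ.1 * (ζ.2 ^ 2 - |ζ.1| ^ (1 + a)) : ℝ) : ℂ))

/-- Stein derivative of order b in the first (ξ) variable of g : ℝ² → ℂ. -/
def steinDxi (b : ℝ) (g : ℝ × ℝ → ℂ) (p : ℝ × ℝ) : ℝ≥0∞ :=
  (∫⁻ y : ℝ, ENNReal.ofReal (‖g p - g (y, p.2)‖ ^ 2 / |p.1 - y| ^ (1 + 2 * b))) ^ (1 / 2 : ℝ)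

/-- The L²(ℝ²) norm of the Stein derivative 𝒟^b_ξ g. -/
def steinL2norm (b : ℝ) (g : ℝ × ℝ → ℂ) : ℝ≥0∞ :=
  (∫⁻ p : ℝ × ℝ, steinDxi b g p ^ 2) ^ (1 / 2 : ℝ)

open scoped FourierTransform SchwartzMap ContDiff

theorem eLpNorm_fourier_eq {E : Type*} [NormedAddCommGroup E] [InnerProductSpace ℝ E]
    [FiniteDimensional ℝ E] [MeasurableSpace E] [BorelSpace E] {f : E → ℂ}
    (hf : Integrable f) (hf2 : MemLp f 2) : eLpNorm (𝓕 f) 2 volume = eLpNorm f 2 volume := by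
  set F : Lp ℂ 2 (volume : Measure E) := hf2.toLp f with hF
  have hcont : Continuous (𝓕 f) :=
    VectorFourier.fourierIntegral_continuous Real.continuous_fourierChar
      (innerSL ℝ).continuous₂ hf
  have key : (𝓕 F : Lp ℂ 2 (volume : Measure E)) =ᵐ[volume] 𝓕 f := by
    apply ae_eq_of_integral_contDiff_smul_eq
    · exact (Lp.memLp _).locallyIntegrable (by norm_num)
    · exact hcont.locallyIntegrable
    · intro g g_smooth g_cpt
      have hg₁ : HasCompactSupport (Complex.ofRealCLM ∘ g) := g_cpt.comp_left rfl
      have hg₂ : ContDiff ℝ ∞ (Complex.ofRealCLM ∘ g) := by fun_prop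
      set φ : 𝓢(E, ℂ) := hg₁.toSchwartzMap hg₂ with hφ
      have h1 : ((𝓕 F : Lp ℂ 2 (volume : Measure E)) : 𝓢'(E, ℂ)) φ = (F : 𝓢'(E, ℂ)) (𝓕 φ) := by
        rw [← Lp.fourier_toTemperedDistribution_eq, TemperedDistribution.fourier_apply]
      rw [Lp.toTemperedDistribution_apply, Lp.toTemperedDistribution_apply] at h1
      have h2 : ∫ x, (𝓕 φ) x • F x = ∫ x, (𝓕 φ) x • f x := by
        apply integral_congr_ae
        filter_upwards [hf2.coeFn_toLp] with x hx
        rw [hx]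
      have h3 : ∫ x, (𝓕 (φ : E → ℂ)) x • f x = ∫ x, φ x • 𝓕 f x := by
        have := VectorFourier.integral_fourierIntegral_smul_eq_flip (e := Real.fourierChar)
          (L := innerₗ E) (μ := volume) (ν := volume) Real.continuous_fourierChar
          (by exact continuous_inner) (φ.integrable (μ := volume)) hf
        rw [flip_innerₗ] at this
        exact this
      rw [h2, SchwartzMap.fourier_coe, h3] at h1
      simpa [hφ] using h1
  calc eLpNorm (𝓕 f) 2 volume = eLpNorm (𝓕 F : Lp ℂ 2 (volume : Measure E)) 2 volume :=
        (eLpNorm_congr_ae key).symm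
    _ = ‖𝓕 F‖ₑ := (Lp.enorm_def _).symm
    _ = ‖F‖ₑ := by
        rw [← ofReal_norm, ← ofReal_norm, Lp.norm_fourier_eq]
    _ = eLpNorm f 2 volume := by rw [Lp.enorm_def, eLpNorm_congr_ae hf2.coeFn_toLp]

theorem exists_lintegral_min_sq_div_rpow_le {θ : ℝ} (hθ : θ ∈ Ioo (0 : ℝ) 1) :
    ∃ K : ℝ≥0∞, K < ⊤ ∧ ∀ L : ℝ, 0 ≤ L →
      ∫⁻ h : ℝ, ENNReal.ofReal (min (L * |h|) 2 ^ 2 / |h| ^ (1 + 2 * θ)) ≤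
        ENNReal.ofReal (L ^ (2 * θ)) * K := by
  obtain ⟨h0, h1⟩ := hθ
  set k : ℝ → ℝ := fun h => min |h| 2 ^ 2 / |h| ^ (1 + 2 * θ) with hk
  have hkm : Measurable k := by unfold k; fun_prop
  have hknn : ∀ h, 0 ≤ k h := fun h => by unfold k; positivity
  have hpos : IntegrableOn k (Ioi 0) := by
    rw [← Ioc_union_Ioi_eq_Ioi (zero_le_one' ℝ)]
    refine IntegrableOn.union ?_ ?_
    · have := (intervalIntegral.intervalIntegrable_rpow' (a := 0) (b := 1)
        (r := 1 - 2 * θ) (by linarith)).1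
      refine Integrable.mono' this hkm.aestronglyMeasurable ?_
      filter_upwards [ae_restrict_mem measurableSet_Ioc] with x hx
      rw [Real.norm_of_nonneg (hknn x)]
      have hx0 := hx.1
      simp only [hk, abs_of_pos hx0]
      rw [min_eq_left (by linarith [hx.2]), ← Real.rpow_natCast, ← Real.rpow_sub hx0]
      apply le_of_eq
      congr 1
      push_cast
      ring
    · have := (integrableOn_Ioi_rpow_of_lt (a := -(1 + 2 * θ)) (by linarith) zero_lt_one).const_mul
        4
      refine Integrable.mono' this hkm.aestronglyMeasurable ?_
      filter_upwards [ae_restrict_mem measurableSet_Ioi] with x hx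
      rw [Real.norm_of_nonneg (hknn x)]
      have hx0 : 0 < x := lt_trans zero_lt_one hx
      simp only [hk, abs_of_pos hx0]
      rw [Real.rpow_neg hx0.le, div_eq_mul_inv]
      have hm : min x 2 ^ 2 ≤ 4 := by
        have h3 : 0 ≤ min x 2 := by positivity
        nlinarith [min_le_right x 2]
      gcongr
  have hi : Integrable ((Ioi 0).indicator k) := hpos.integrable_indicator measurableSet_Ioi
  have hkint : Integrable k := by
    refine (hi.add hi.comp_neg).congr ?_
    filter_upwards [Measure.ae_ne volume (0 : ℝ)] with x hx
    rcases lt_or_gt_of_ne hx with h | h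
    · simp [indicator, h, not_lt.2 h.le, hk]
    · simp [indicator, h, not_lt.2 h.le, hk]
  refine ⟨∫⁻ h, ENNReal.ofReal (k h), ?_, ?_⟩
  · exact hkint.lintegral_lt_top
  · intro L hL
    rcases hL.eq_or_lt with rfl | hL
    · simp
    have hpt : ∀ h : ℝ, ENNReal.ofReal (min (L * |h|) 2 ^ 2 / |h| ^ (1 + 2 * θ)) =
        ENNReal.ofReal (L ^ (1 + 2 * θ)) * ENNReal.ofReal (k (L * h)) := by
      intro h
      rw [← ENNReal.ofReal_mul (by positivity)]
      congr 1
      simp only [hk, abs_mul, abs_of_pos hL]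
      rw [Real.mul_rpow hL.le (abs_nonneg h)]
      have : L ^ (1 + 2 * θ) ≠ 0 := by positivity
      rw [← mul_div_assoc, mul_div_mul_left _ _ this]
    simp_rw [hpt]
    rw [lintegral_const_mul' _ _ ENNReal.ofReal_ne_top]
    have hmap := lintegral_map (μ := volume) (f := fun x => ENNReal.ofReal (k x))
      (g := fun h : ℝ => L * h) (by fun_prop) (by fun_prop)
    rw [Real.map_volume_mul_left hL.ne', lintegral_smul_measure] at hmap
    rw [← hmap, smul_eq_mul, ← mul_assoc, ← ENNReal.ofReal_mul (by positivity),
      abs_of_pos (by positivity)]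
    gcongr
    rw [Real.rpow_add hL, Real.rpow_one]
    apply le_of_eq
    field_simp

theorem eLpNorm_two_sq {α : Type*} [MeasurableSpace α] (μ : Measure α) (f : α → ℂ) :
    eLpNorm f 2 μ ^ 2 = ∫⁻ x, ‖f x‖ₑ ^ 2 ∂μ := by
  rw [eLpNorm_eq_lintegral_rpow_enorm_toReal (by norm_num) (by norm_num), ← ENNReal.rpow_natCast,
    ← ENNReal.rpow_mul]
  simp

theorem FT_eq_fourier (f : ℝ × ℝ → ℂ) (ζ : ℝ × ℝ) :
    FT f ζ = 𝓕 (fun v : WithLp 2 (ℝ × ℝ) => f (WithLp.ofLp v))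
      (WithLp.toLp 2 ((2 * Real.pi)⁻¹ • ζ)) := by
  rw [Real.fourier_eq',
    ← (WithLp.volume_preserving_symm_measurableEquiv_toLp_prod ℝ ℝ).symm.integral_comp']
  simp only [FT]
  refine integral_congr_ae (Filter.Eventually.of_forall fun p => ?_)
  simp only [smul_eq_mul]
  congr 2
  simp [WithLp.prod_inner_apply]
  field_simp

theorem integrable_comp_ofLp {f : ℝ × ℝ → ℂ} (hf : Integrable f) :
    Integrable (fun v : WithLp 2 (ℝ × ℝ) => f (WithLp.ofLp v)) :=
  (WithLp.volume_preserving_ofLp ℝ ℝ).integrable_comp_of_integrable hf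

theorem continuous_FT {f : ℝ × ℝ → ℂ} (hf : Integrable f) : Continuous (FT f) := by
  have hc : Continuous (𝓕 (fun v : WithLp 2 (ℝ × ℝ) => f (WithLp.ofLp v))) :=
    VectorFourier.fourierIntegral_continuous Real.continuous_fourierChar
      (innerSL ℝ).continuous₂ (integrable_comp_ofLp hf)
  rw [funext (FT_eq_fourier f)]
  exact hc.comp (by fun_prop)

theorem lintegral_FT_sq {f : ℝ × ℝ → ℂ} (hf : Integrable f) (hf2 : MemLp f 2) :
    ∫⁻ ζ, ‖FT f ζ‖ₑ ^ 2 = ENNReal.ofReal ((2 * Real.pi) ^ 2) * ∫⁻ p, ‖f p‖ₑ ^ 2 := by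
  set F : WithLp 2 (ℝ × ℝ) → ℂ := fun v => f (WithLp.ofLp v) with hF
  have hmp := WithLp.volume_preserving_ofLp ℝ ℝ
  have hmp' := (WithLp.volume_preserving_symm_measurableEquiv_toLp_prod ℝ ℝ)
  have hpl := eLpNorm_fourier_eq (integrable_comp_ofLp hf) (hf2.comp_measurePreserving hmp)
  have hpl2 : ∫⁻ v, ‖𝓕 F v‖ₑ ^ 2 = ∫⁻ v, ‖F v‖ₑ ^ 2 := by
    rw [← eLpNorm_two_sq, ← eLpNorm_two_sq, hpl]
  have hFf : ∫⁻ v, ‖F v‖ₑ ^ 2 = ∫⁻ p, ‖f p‖ₑ ^ 2 :=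
    hmp'.lintegral_comp_emb (MeasurableEquiv.measurableEmbedding _) (fun p => ‖f p‖ₑ ^ 2)
  have hG : ∫⁻ v, ‖𝓕 F v‖ₑ ^ 2 = ∫⁻ p, ‖𝓕 F (WithLp.toLp 2 p)‖ₑ ^ 2 :=
    (hmp'.symm.lintegral_comp_emb (MeasurableEquiv.measurableEmbedding _)
      (fun v => ‖𝓕 F v‖ₑ ^ 2)).symm
  have hs : ∫⁻ ζ, ‖FT f ζ‖ₑ ^ 2 =
      ENNReal.ofReal ((2 * Real.pi) ^ 2) * ∫⁻ p, ‖𝓕 F (WithLp.toLp 2 p)‖ₑ ^ 2 := by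
    simp_rw [FT_eq_fourier f]
    have hpi : (2 * Real.pi)⁻¹ ≠ 0 := by positivity
    have h := (MeasurableEquiv.smul₀ (α := ℝ × ℝ) _ hpi).measurableEmbedding.lintegral_map
      (μ := volume) (fun p => ‖𝓕 F (WithLp.toLp 2 p)‖ₑ ^ 2)
    rw [MeasurableEquiv.coe_smul₀, Measure.map_addHaar_smul _ hpi, lintegral_smul_measure] at h
    rw [← h]
    have hfin : Module.finrank ℝ (ℝ × ℝ) = 2 := by simp
    rw [hfin, ← inv_pow, inv_inv, abs_of_pos (by positivity), smul_eq_mul]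
  rw [hs, ← hG, hpl2, hFf]

theorem FT_sub_FT_add {f : ℝ × ℝ → ℂ} (hf : Integrable f) (h : ℝ) (ζ : ℝ × ℝ) :
    FT f ζ - FT f (ζ.1 + h, ζ.2) =
      FT (fun p => (1 - Complex.exp (Complex.I * ((-(p.1 * h) : ℝ) : ℂ))) * f p) ζ := by
  have hint : ∀ ξ : ℝ × ℝ, Integrable fun p : ℝ × ℝ =>
      Complex.exp (-(Complex.I * ((p.1 * ξ.1 + p.2 * ξ.2 : ℝ) : ℂ))) * f p := by
    intro ξ
    refine hf.bdd_mul (c := 1) (by fun_prop) (Filter.Eventually.of_forall fun p => ?_)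
    rw [Complex.norm_exp]
    simp
  simp only [FT]
  rw [← integral_sub (hint _) (hint (ζ.1 + h, ζ.2))]
  refine integral_congr_ae (Filter.Eventually.of_forall fun p => ?_)
  have : Complex.exp (-(Complex.I * ((p.1 * (ζ.1 + h) + p.2 * ζ.2 : ℝ) : ℂ))) =
      Complex.exp (-(Complex.I * ((p.1 * ζ.1 + p.2 * ζ.2 : ℝ) : ℂ))) *
        Complex.exp (Complex.I * ((-(p.1 * h) : ℝ) : ℂ)) := by
    rw [← Complex.exp_add]
    congr 1
    push_cast
    ring
  simp only [this]
  ring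

theorem norm_one_sub_exp_le (x : ℝ) :
    ‖1 - Complex.exp (Complex.I * (x : ℂ))‖ ≤ min |x| 2 := by
  rw [norm_sub_rev]
  refine le_min Real.norm_exp_I_mul_ofReal_sub_one_le ?_
  rw [Complex.norm_exp_I_mul_ofReal_sub_one, norm_mul, Real.norm_ofNat]
  nlinarith [Real.abs_sin_le_one (x / 2), Real.norm_eq_abs (Real.sin (x / 2))]

theorem lintegral_stein_FT_le {θ : ℝ} {K : ℝ≥0∞}
    (hK : ∀ L : ℝ, 0 ≤ L → ∫⁻ h : ℝ, ENNReal.ofReal (min (L * |h|) 2 ^ 2 / |h| ^ (1 + 2 * θ)) ≤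
      ENNReal.ofReal (L ^ (2 * θ)) * K)
    (hKt : K ≠ ⊤) {f : ℝ × ℝ → ℂ} (hf : Integrable f) (hf2 : MemLp f 2) :
    ∫⁻ p : ℝ × ℝ, ∫⁻ h : ℝ,
        ENNReal.ofReal (‖FT f p - FT f (p.1 + h, p.2)‖ ^ 2 / |h| ^ (1 + 2 * θ)) ≤
      ENNReal.ofReal ((2 * Real.pi) ^ 2) * K *
        ∫⁻ p : ℝ × ℝ, ‖((|p.1| ^ θ : ℝ) : ℂ) * f p‖ₑ ^ 2 := by
  have hFT := (continuous_FT hf).measurable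
  set w : ℝ → ℝ≥0∞ := fun h => ENNReal.ofReal ((|h| ^ (1 + 2 * θ))⁻¹) with hw
  have hwm : Measurable w := by unfold w; fun_prop
  set e : ℝ × ℝ → ℝ → ℂ :=
    fun p h => 1 - Complex.exp (Complex.I * ((-(p.1 * h) : ℝ) : ℂ)) with he
  have hsplit : ∀ (z : ℂ) (h : ℝ),
      ENNReal.ofReal (‖z‖ ^ 2 / |h| ^ (1 + 2 * θ)) = w h * ‖z‖ₑ ^ 2 := by
    intro z h
    rw [div_eq_inv_mul, ENNReal.ofReal_mul (by positivity), ENNReal.ofReal_pow (norm_nonneg _),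
      ofReal_norm]
  have hslice : ∀ h : ℝ, ∫⁻ p : ℝ × ℝ, ‖FT f p - FT f (p.1 + h, p.2)‖ₑ ^ 2 =
      ENNReal.ofReal ((2 * Real.pi) ^ 2) * ∫⁻ p : ℝ × ℝ, ‖e p h * f p‖ₑ ^ 2 := by
    intro h
    have hem : AEStronglyMeasurable (fun p : ℝ × ℝ => e p h) volume := by
      unfold e
      fun_prop
    have heb : ∀ᵐ p : ℝ × ℝ, ‖e p h‖ ≤ 2 := Filter.Eventually.of_forall fun p =>
      (norm_one_sub_exp_le _).trans (min_le_right _ _)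
    have h1 : Integrable (fun p => e p h * f p) := hf.bdd_mul hem heb
    have h2 : MemLp (fun p => e p h * f p) 2 :=
      hf2.of_le_mul (c := 2) (hem.mul hf2.1) (heb.mono fun p hp => by rw [norm_mul]; gcongr)
    rw [← lintegral_FT_sq h1 h2]
    exact lintegral_congr fun p => by rw [FT_sub_FT_add hf]
  calc ∫⁻ p : ℝ × ℝ, ∫⁻ h : ℝ,
        ENNReal.ofReal (‖FT f p - FT f (p.1 + h, p.2)‖ ^ 2 / |h| ^ (1 + 2 * θ))
      = ∫⁻ h : ℝ, ∫⁻ p : ℝ × ℝ, w h * ‖FT f p - FT f (p.1 + h, p.2)‖ₑ ^ 2 := by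
        simp_rw [hsplit]
        refine lintegral_lintegral_swap (Measurable.aemeasurable ?_)
        unfold Function.uncurry
        fun_prop
    _ = ENNReal.ofReal ((2 * Real.pi) ^ 2) *
          ∫⁻ h : ℝ, ∫⁻ p : ℝ × ℝ, w h * ‖e p h * f p‖ₑ ^ 2 := by
        rw [← lintegral_const_mul' _ _ ENNReal.ofReal_ne_top]
        refine lintegral_congr fun h => ?_
        rw [lintegral_const_mul' _ _ ENNReal.ofReal_ne_top, hslice,
          lintegral_const_mul' _ _ ENNReal.ofReal_ne_top, mul_left_comm]
    _ = ENNReal.ofReal ((2 * Real.pi) ^ 2) *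
          ∫⁻ p : ℝ × ℝ, ∫⁻ h : ℝ, w h * ‖e p h * f p‖ₑ ^ 2 := by
        congr 1
        refine (lintegral_lintegral_swap ?_).symm
        have hfm : AEMeasurable (fun q : (ℝ × ℝ) × ℝ => f q.1)
            ((volume : Measure (ℝ × ℝ)).prod (volume : Measure ℝ)) :=
          hf2.1.aemeasurable.comp_fst
        have hem : Measurable (fun q : (ℝ × ℝ) × ℝ => e q.1 q.2) := by
          unfold e
          fun_prop
        exact (hwm.comp measurable_snd).aemeasurable.mul
          ((hem.aemeasurable.mul hfm).enorm.pow_const 2)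
    _ ≤ ENNReal.ofReal ((2 * Real.pi) ^ 2) *
          ∫⁻ p : ℝ × ℝ, K * ‖((|p.1| ^ θ : ℝ) : ℂ) * f p‖ₑ ^ 2 := by
        gcongr with p
        have hp : ∀ h : ℝ, w h * ‖e p h * f p‖ₑ ^ 2 ≤
            ‖f p‖ₑ ^ 2 *
              ENNReal.ofReal (min (|p.1| * |h|) 2 ^ 2 / |h| ^ (1 + 2 * θ)) := by
          intro h
          rw [enorm_mul, mul_pow, ← mul_assoc, mul_comm, ← hsplit]
          gcongr
          refine (norm_one_sub_exp_le _).trans_eq ?_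
          rw [abs_neg, abs_mul]
        refine (lintegral_mono hp).trans ?_
        rw [lintegral_const_mul' _ _ (by simp)]
        refine (mul_le_mul_right (hK _ (abs_nonneg p.1)) _).trans_eq ?_
        rw [enorm_mul, mul_pow]
        have : ‖((|p.1| ^ θ : ℝ) : ℂ)‖ₑ ^ 2 = ENNReal.ofReal (|p.1| ^ (2 * θ)) := by
          rw [← ofReal_norm, ← ENNReal.ofReal_pow (norm_nonneg _), Complex.norm_real,
            Real.norm_of_nonneg (by positivity), mul_comm 2 θ, Real.rpow_mul (abs_nonneg _),
            Real.rpow_ofNat]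
        rw [this]
        ring
    _ = _ := by
        rw [lintegral_const_mul' _ _ hKt, mul_assoc]

theorem exists_cutoff_psi_bound {a : ℝ} (σ₃ : ℕ) (ha : 0 < a)
    {ϕ₀ : ℝ → ℝ} (hϕ_smooth : ContDiff ℝ (⊤ : ℕ∞) ϕ₀)
    (hϕ_supp : tsupport ϕ₀ ⊆ Icc (-2 : ℝ) 2) (t : ℝ) :
    let m : ℝ × ℝ → ℂ := fun ζ => ((ϕ₀ ζ.1 * ϕ₀ ζ.2 * ζ.2 ^ σ₃ : ℝ) : ℂ) * psi a t ζ
    ∃ c : ℝ, 0 ≤ c ∧ (∀ ζ, ‖m ζ‖ ≤ c) ∧ ∀ (p : ℝ × ℝ) (h : ℝ),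
        ‖m p - m (p.1 + h, p.2)‖ ≤ c * min (1 * |h|) 2 := by
  intro m
  have hϕ1 : ContDiff ℝ 1 ϕ₀ := hϕ_smooth.of_le (by exact_mod_cast le_top)
  have habs : ContDiff ℝ 1 (fun x : ℝ => |x| ^ (1 + a)) := contDiff_norm_rpow (by linarith)
  have hsm : ContDiff ℝ 1 m := by
    have h1 : ContDiff ℝ 1 (fun ζ : ℝ × ℝ => ϕ₀ ζ.1 * ϕ₀ ζ.2 * ζ.2 ^ σ₃) := by fun_prop
    have h2 : ContDiff ℝ 1 (fun ζ : ℝ × ℝ => t * ζ.1 * (ζ.2 ^ 2 - |ζ.1| ^ (1 + a))) := by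
      have := habs.comp (contDiff_fst (𝕜 := ℝ) (E := ℝ) (F := ℝ))
      simp only [Function.comp_def] at this
      fun_prop
    exact (Complex.ofRealCLM.contDiff.comp h1).mul
      (contDiff_const.mul (Complex.ofRealCLM.contDiff.comp h2)).cexp
  have hsupp : HasCompactSupport m := by
    refine HasCompactSupport.intro (isCompact_Icc.prod isCompact_Icc :
      IsCompact (Icc (-2 : ℝ) 2 ×ˢ Icc (-2 : ℝ) 2)) fun ζ hζ => ?_
    have hz : ∀ x, x ∉ Icc (-2 : ℝ) 2 → ϕ₀ x = 0 := fun x hx =>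
      image_eq_zero_of_notMem_tsupport fun h => hx (hϕ_supp h)
    rw [mem_prod, not_and_or] at hζ
    rcases hζ with h | h <;> simp [m, hz _ h]
  obtain ⟨L, hL⟩ := ContDiff.lipschitzWith_of_hasCompactSupport hsupp hsm one_ne_zero
  obtain ⟨M, hM⟩ := hsupp.exists_bound_of_continuous hsm.continuous
  have hM0 : 0 ≤ M := (norm_nonneg _).trans (hM 0)
  refine ⟨max L M, by positivity, fun ζ => (hM ζ).trans (le_max_right _ _), fun p h => ?_⟩
  rw [mul_min_of_nonneg _ _ (by positivity)]
  refine le_min ?_ ?_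
  · have h1 := hL.dist_le_mul p (p.1 + h, p.2)
    rw [dist_eq_norm] at h1
    refine h1.trans ?_
    have : dist p (p.1 + h, p.2) = |h| := by simp [Prod.dist_eq]
    rw [this, one_mul]
    gcongr
    exact le_max_left _ _
  · refine (norm_sub_le _ _).trans ?_
    have := hM p
    have := hM (p.1 + h, p.2)
    linarith [le_max_right (L : ℝ) M]

theorem steinDxi_sq (θ : ℝ) (g : ℝ × ℝ → ℂ) (p : ℝ × ℝ) :
    steinDxi θ g p ^ 2 =
      ∫⁻ h : ℝ, ENNReal.ofReal (‖g p - g (p.1 + h, p.2)‖ ^ 2 / |h| ^ (1 + 2 * θ)) := by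
  rw [steinDxi, ← ENNReal.rpow_natCast, ← ENNReal.rpow_mul]
  norm_num
  rw [← lintegral_add_left_eq_self _ p.1]
  simp

theorem norm_mul_sub_mul_sq_le {m m' g g' : ℂ} {c r : ℝ}
    (hm' : ‖m'‖ ≤ c) (hmm : ‖m - m'‖ ≤ c * r) :
    ‖m * g - m' * g'‖ ^ 2 ≤ 2 * c ^ 2 * (‖g‖ ^ 2 * r ^ 2 + ‖g - g'‖ ^ 2) := by
  have h1 : ‖m * g - m' * g'‖ ≤ c * r * ‖g‖ + c * ‖g - g'‖ := by
    rw [show m * g - m' * g' = (m - m') * g + m' * (g - g') by ring]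
    refine (norm_add_le _ _).trans ?_
    rw [norm_mul, norm_mul]
    gcongr
  calc ‖m * g - m' * g'‖ ^ 2 ≤ (c * r * ‖g‖ + c * ‖g - g'‖) ^ 2 := by gcongr
    _ ≤ _ := by nlinarith [sq_nonneg (c * r * ‖g‖ - c * ‖g - g'‖)]

/-- Lemma 2.13, estimate (2.13): 𝒟^θ_ξ(χ ψ η^{σ₃} f̂) is controlled by ‖f‖ + ‖|x|^θ f‖. -/
theorem steinDxi_cutoff_eta_pow_bound
    (a θ : ℝ) (σ₃ : ℕ) (ha : a ∈ Ioo (0 : ℝ) 1) (hθ : θ ∈ Ioo (0 : ℝ) 1)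
    (ϕ₀ : ℝ → ℝ) (hϕ_smooth : ContDiff ℝ (⊤ : ℕ∞) ϕ₀)
    (hϕ_supp : tsupport ϕ₀ ⊆ Icc (-2 : ℝ) 2)
    (hϕ_one : ∀ x ∈ Ioo (-1 : ℝ) 1, ϕ₀ x = 1)
    (t : ℝ) (ht : 0 ≤ t) :
    ∃ C : ℝ, 0 < C ∧ ∀ f : ℝ × ℝ → ℂ,
      eLpNorm f 2 (volume : Measure (ℝ × ℝ)) < ⊤ →
      eLpNorm (fun p : ℝ × ℝ => ((|p.1| ^ θ : ℝ) : ℂ) * f p) 2 (volume : Measure (ℝ × ℝ)) < ⊤ →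
      steinL2norm θ
          (fun ζ => ((ϕ₀ ζ.1 * ϕ₀ ζ.2 * ζ.2 ^ σ₃ : ℝ) : ℂ) * psi a t ζ * FT f ζ) ≤
        ENNReal.ofReal C *
          (eLpNorm f 2 (volume : Measure (ℝ × ℝ)) +
            eLpNorm (fun p : ℝ × ℝ => ((|p.1| ^ θ : ℝ) : ℂ) * f p) 2
              (volume : Measure (ℝ × ℝ))) := by
  obtain ⟨K, hKt, hK⟩ := exists_lintegral_min_sq_div_rpow_le hθ
  obtain ⟨c, hc0, hmb, hmd⟩ := exists_cutoff_psi_bound σ₃ ha.1 hϕ_smooth hϕ_supp t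
  set m : ℝ × ℝ → ℂ := fun ζ => ((ϕ₀ ζ.1 * ϕ₀ ζ.2 * ζ.2 ^ σ₃ : ℝ) : ℂ) * psi a t ζ
  set A : ℝ≥0∞ := ENNReal.ofReal (2 * c ^ 2) * (ENNReal.ofReal ((2 * Real.pi) ^ 2) * K) with hA
  have hAt : A ^ (1 / 2 : ℝ) ≠ ⊤ := by
    have : A ≠ ⊤ := by finiteness
    finiteness
  refine ⟨(A ^ (1 / 2 : ℝ)).toReal + 1, by positivity, fun f hf hxf => ?_⟩
  by_cases hint : Integrable f
  swap
  · have hFT : ∀ ζ, FT f ζ = 0 := by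
      intro ζ
      refine integral_undef fun h => hint ?_
      have h2 := h.bdd_mul (c := 1)
        (f := fun p : ℝ × ℝ => Complex.exp (Complex.I * ((p.1 * ζ.1 + p.2 * ζ.2 : ℝ) : ℂ)))
        (by fun_prop) (Filter.Eventually.of_forall fun p => by rw [Complex.norm_exp]; simp)
      refine h2.congr (Filter.Eventually.of_forall fun p => ?_)
      simp only
      rw [← mul_assoc, ← Complex.exp_add]
      simp
    simp [steinL2norm, steinDxi_sq, hFT]
  have hf2 : MemLp f 2 := ⟨hint.1, hf⟩
  set N := eLpNorm f 2 (volume : Measure (ℝ × ℝ)) with hN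
  set X := eLpNorm (fun p : ℝ × ℝ => ((|p.1| ^ θ : ℝ) : ℂ) * f p) 2
    (volume : Measure (ℝ × ℝ)) with hX
  have hpt : ∀ p : ℝ × ℝ, steinDxi θ (fun ζ => m ζ * FT f ζ) p ^ 2 ≤
      ENNReal.ofReal (2 * c ^ 2) * (‖FT f p‖ₑ ^ 2 * K + ∫⁻ h : ℝ,
        ENNReal.ofReal (‖FT f p - FT f (p.1 + h, p.2)‖ ^ 2 / |h| ^ (1 + 2 * θ))) := by
    intro p
    rw [steinDxi_sq]
    have hp : ∀ h : ℝ, ENNReal.ofReal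
        (‖m p * FT f p - m (p.1 + h, p.2) * FT f (p.1 + h, p.2)‖ ^ 2 / |h| ^ (1 + 2 * θ)) ≤
        ENNReal.ofReal (2 * c ^ 2) * (‖FT f p‖ₑ ^ 2 *
          ENNReal.ofReal (min (1 * |h|) 2 ^ 2 / |h| ^ (1 + 2 * θ)) +
          ENNReal.ofReal (‖FT f p - FT f (p.1 + h, p.2)‖ ^ 2 / |h| ^ (1 + 2 * θ))) := by
      intro h
      rw [← ofReal_norm, ← ENNReal.ofReal_pow (norm_nonneg _), ← ENNReal.ofReal_mul (by positivity),
        ← ENNReal.ofReal_add (by positivity) (by positivity), ← ENNReal.ofReal_mul (by positivity),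
        ← mul_div_assoc, ← add_div, ← mul_div_assoc]
      gcongr
      exact norm_mul_sub_mul_sq_le (hmb _) (hmd p h)
    refine (lintegral_mono hp).trans ?_
    rw [lintegral_const_mul' _ _ ENNReal.ofReal_ne_top, lintegral_add_left (by fun_prop),
      lintegral_const_mul' _ _ (by simp)]
    have h1 := hK 1 zero_le_one
    rw [Real.one_rpow, ENNReal.ofReal_one, one_mul] at h1
    gcongr
  have hmain : ∫⁻ p : ℝ × ℝ, steinDxi θ (fun ζ => m ζ * FT f ζ) p ^ 2 ≤ A * (N + X) ^ 2 := by
    refine (lintegral_mono hpt).trans ?_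
    have hFT := (continuous_FT hint).measurable
    rw [lintegral_const_mul' _ _ ENNReal.ofReal_ne_top, lintegral_add_left (by fun_prop),
      lintegral_mul_const' _ _ hKt.ne, lintegral_FT_sq hint hf2, ← eLpNorm_two_sq, ← hN]
    have h2 := lintegral_stein_FT_le hK hKt.ne hint hf2
    rw [← eLpNorm_two_sq, ← hX] at h2
    calc _ ≤ ENNReal.ofReal (2 * c ^ 2) * (ENNReal.ofReal ((2 * Real.pi) ^ 2) * N ^ 2 * K +
          ENNReal.ofReal ((2 * Real.pi) ^ 2) * K * X ^ 2) := by gcongr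
      _ = A * (N ^ 2 + X ^ 2) := by rw [hA]; ring
      _ ≤ A * (N + X) ^ 2 := by
        gcongr
        rw [add_sq]
        gcongr
        exact le_self_add
  calc steinL2norm θ (fun ζ => m ζ * FT f ζ)
      ≤ (A * (N + X) ^ 2) ^ (1 / 2 : ℝ) := by
        unfold steinL2norm
        gcongr
    _ = A ^ (1 / 2 : ℝ) * (N + X) := by
        rw [ENNReal.mul_rpow_of_nonneg _ _ (by norm_num), ← ENNReal.rpow_natCast,
          ← ENNReal.rpow_mul]
        norm_num
    _ ≤ _ := by
        gcongr
        rw [← ENNReal.ofReal_toReal hAt]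
        apply ENNReal.ofReal_le_ofReal
        simp
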